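/- Let a ≥ 0, N ≥ 5 and 1 < p < (N+4+2a)/(N−4). Let u be a positive C⁴ solution of Δ²u = |x|^a u^p on ℝ^N that is stable outside a compact set Σ ⊂ ℝ^N. Then Δu ∈ L²(ℝ^N) and |x|^a u^{p+1} ∈ L¹(ℝ^N), i.e. ∫_{ℝ^N} |Δu|² < ∞ and ∫_{ℝ^N} |x|^a u^{p+1} < ∞. -/

import Mathlib

open MeasureTheory Real Metric

/-- The Laplacian of a function on Euclidean space, as the sum of its second
partial derivatives in the coordinate directions. -/
noncomputable def lap {N : ℕ} (f : EuclideanSpace ℝ (Fin N) → ℝ)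
    (x : EuclideanSpace ℝ (Fin N)) : ℝ :=
  ∑ i : Fin N,
    fderiv ℝ (fun y => fderiv ℝ f y (EuclideanSpace.single i 1)) x (EuclideanSpace.single i 1)

/-- partial derivative -/
noncomputable def pd {N : ℕ} (i : Fin N) (f : EuclideanSpace ℝ (Fin N) → ℝ)
    (x : EuclideanSpace ℝ (Fin N)) : ℝ := fderiv ℝ f x (EuclideanSpace.single i 1)

/-- inner product of gradients -/
noncomputable def gam {N : ℕ} (f g : EuclideanSpace ℝ (Fin N) → ℝ)
    (x : EuclideanSpace ℝ (Fin N)) : ℝ := ∑ i : Fin N, pd i f x * pd i g x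

lemma lap_eq {N : ℕ} (f : EuclideanSpace ℝ (Fin N) → ℝ) (x : EuclideanSpace ℝ (Fin N)) :
    lap f x = ∑ i : Fin N, pd i (pd i f) x := rfl

lemma pd_contDiff {N : ℕ} (i : Fin N) {f : EuclideanSpace ℝ (Fin N) → ℝ} {m n : ℕ}
    (hf : ContDiff ℝ n f) (h : m + 1 ≤ n) : ContDiff ℝ m (pd i f) := by
  have h1 : ContDiff ℝ m (fderiv ℝ f) := hf.fderiv_right (by exact_mod_cast h)
  exact h1.clm_apply contDiff_const

lemma lap_contDiff {N : ℕ} {f : EuclideanSpace ℝ (Fin N) → ℝ} {m n : ℕ}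
    (hf : ContDiff ℝ n f) (h : m + 2 ≤ n) : ContDiff ℝ m (lap f) := by
  have : lap f = fun x => ∑ i : Fin N, pd i (pd i f) x := rfl
  rw [this]
  refine ContDiff.sum fun i _ => ?_
  exact pd_contDiff (n := m + 1) i (pd_contDiff i hf (by omega)) le_rfl

lemma gam_continuous {N : ℕ} {f g : EuclideanSpace ℝ (Fin N) → ℝ}
    (hf : ContDiff ℝ 2 f) (hg : ContDiff ℝ 2 g) : Continuous (gam f g) := by
  have h1 : ∀ i, Continuous (pd i f) := fun i =>
    (pd_contDiff (n := 2) (m := 1) i hf le_rfl).continuous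
  have h2 : ∀ i, Continuous (pd i g) := fun i =>
    (pd_contDiff (n := 2) (m := 1) i hg le_rfl).continuous
  unfold gam
  fun_prop

lemma lap_continuous {N : ℕ} {f : EuclideanSpace ℝ (Fin N) → ℝ}
    (hf : ContDiff ℝ 2 f) : Continuous (lap f) :=
  (lap_contDiff (n := 2) (m := 0) hf le_rfl).continuous

lemma pd_mul {N : ℕ} (i : Fin N) {f g : EuclideanSpace ℝ (Fin N) → ℝ}
    {x : EuclideanSpace ℝ (Fin N)} (hf : DifferentiableAt ℝ f x) (hg : DifferentiableAt ℝ g x) :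
    pd i (fun y => f y * g y) x = f x * pd i g x + g x * pd i f x := by
  unfold pd
  rw [fderiv_fun_mul hf hg]
  simp

lemma lap_mul {N : ℕ} {f g : EuclideanSpace ℝ (Fin N) → ℝ}
    (hf : ContDiff ℝ 2 f) (hg : ContDiff ℝ 2 g) (x : EuclideanSpace ℝ (Fin N)) :
    lap (fun y => f y * g y) x = f x * lap g x + 2 * gam f g x + g x * lap f x := by
  have df : Differentiable ℝ f := hf.differentiable (by norm_num)
  have dg : Differentiable ℝ g := hg.differentiable (by norm_num)
  have dpf : ∀ i, Differentiable ℝ (pd i f) := fun i =>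
    (pd_contDiff (n := 2) (m := 1) i hf le_rfl).differentiable (by norm_num)
  have dpg : ∀ i, Differentiable ℝ (pd i g) := fun i =>
    (pd_contDiff (n := 2) (m := 1) i hg le_rfl).differentiable (by norm_num)
  have h1 : ∀ i, pd i (fun y => f y * g y) = fun y => f y * pd i g y + g y * pd i f y := by
    intro i; funext y; exact pd_mul i (df y) (dg y)
  simp only [lap_eq, gam, h1, Finset.mul_sum, ← Finset.sum_add_distrib]
  refine Finset.sum_congr rfl fun i _ => ?_
  have h2 : pd i (fun y => f y * pd i g y + g y * pd i f y) x =
      pd i (fun y => f y * pd i g y) x + pd i (fun y => g y * pd i f y) x := by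
    unfold pd
    rw [fderiv_fun_add]
    · simp
    · exact (df x).mul (dpg i x)
    · exact (dg x).mul (dpf i x)
  rw [h2, pd_mul i (df x) (dpg i x), pd_mul i (dg x) (dpf i x)]
  ring

lemma pd_comp {N : ℕ} (i : Fin N) {g : EuclideanSpace ℝ (Fin N) → ℝ} {G : ℝ → ℝ} {G' : ℝ}
    {x : EuclideanSpace ℝ (Fin N)} (hg : DifferentiableAt ℝ g x) (hG : HasDerivAt G G' (g x)) :
    pd i (fun y => G (g y)) x = G' * pd i g x := by
  unfold pd
  have := hG.comp_hasFDerivAt x hg.hasFDerivAt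
  have h2 : fderiv ℝ (fun y => G (g y)) x = G' • fderiv ℝ g x := this.fderiv
  rw [h2]; simp

lemma gam_comp {N : ℕ} {f g : EuclideanSpace ℝ (Fin N) → ℝ} {G : ℝ → ℝ} {G' : ℝ}
    {x : EuclideanSpace ℝ (Fin N)} (hg : DifferentiableAt ℝ g x) (hG : HasDerivAt G G' (g x)) :
    gam f (fun y => G (g y)) x = G' * gam f g x := by
  simp only [gam, pd_comp _ hg hG, Finset.mul_sum]
  exact Finset.sum_congr rfl fun i _ => by ring

lemma gam_comm {N : ℕ} (f g : EuclideanSpace ℝ (Fin N) → ℝ) (x : EuclideanSpace ℝ (Fin N)) :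
    gam f g x = gam g f x := Finset.sum_congr rfl fun i _ => mul_comm _ _

lemma gam_mul {N : ℕ} {h f g : EuclideanSpace ℝ (Fin N) → ℝ}
    {x : EuclideanSpace ℝ (Fin N)} (hf : DifferentiableAt ℝ f x) (hg : DifferentiableAt ℝ g x) :
    gam h (fun y => f y * g y) x = f x * gam h g x + g x * gam h f x := by
  simp only [gam, pd_mul _ hf hg, Finset.mul_sum, ← Finset.sum_add_distrib]
  exact Finset.sum_congr rfl fun i _ => by ring

lemma gam_self_nonneg {N : ℕ} (f : EuclideanSpace ℝ (Fin N) → ℝ) (x : EuclideanSpace ℝ (Fin N)) :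
    0 ≤ gam f f x := Finset.sum_nonneg fun i _ => mul_self_nonneg _

lemma gam_sq_le {N : ℕ} (f g : EuclideanSpace ℝ (Fin N) → ℝ) (x : EuclideanSpace ℝ (Fin N)) :
    gam f g x ^ 2 ≤ gam f f x * gam g g x := by
  have := Finset.sum_mul_sq_le_sq_mul_sq Finset.univ (fun i => pd i f x) (fun i => pd i g x)
  simpa [gam, sq] using this

lemma lap_comp {N : ℕ} {g : EuclideanSpace ℝ (Fin N) → ℝ} {G G1 G2 : ℝ → ℝ}
    (hg : ContDiff ℝ 2 g) (hG : ∀ x, HasDerivAt G (G1 (g x)) (g x))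
    (hG1 : ∀ x, HasDerivAt G1 (G2 (g x)) (g x)) (x : EuclideanSpace ℝ (Fin N)) :
    lap (fun y => G (g y)) x = G2 (g x) * gam g g x + G1 (g x) * lap g x := by
  have dg : Differentiable ℝ g := hg.differentiable (by norm_num)
  have dpg : ∀ i, Differentiable ℝ (pd i g) := fun i =>
    (pd_contDiff (n := 2) (m := 1) i hg le_rfl).differentiable (by norm_num)
  have h1 : ∀ i, pd i (fun y => G (g y)) = fun y => G1 (g y) * pd i g y := by
    intro i; funext y; exact pd_comp i (dg y) (hG y)
  simp only [lap_eq, gam, h1, Finset.mul_sum, ← Finset.sum_add_distrib]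
  refine Finset.sum_congr rfl fun i _ => ?_
  have h3 : DifferentiableAt ℝ (fun y => G1 (g y)) x :=
    ((hG1 x).comp_hasFDerivAt x (dg x).hasFDerivAt).differentiableAt
  rw [pd_mul i h3 (dpg i x), pd_comp i (dg x) (hG1 x)]
  ring

lemma pd_normsq {N : ℕ} (i : Fin N) (x : EuclideanSpace ℝ (Fin N)) :
    pd i (fun y => ‖y‖ ^ 2) x = 2 * x i := by
  unfold pd
  rw [fderiv_norm_sq_apply]
  simp [EuclideanSpace.inner_single_right]

lemma gam_normsq {N : ℕ} (x : EuclideanSpace ℝ (Fin N)) :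
    gam (fun y => ‖y‖ ^ 2) (fun y => ‖y‖ ^ 2) x = 4 * ‖x‖ ^ 2 := by
  simp only [gam, pd_normsq]
  rw [EuclideanSpace.real_norm_sq_eq, Finset.mul_sum]
  exact Finset.sum_congr rfl fun i _ => by ring

lemma lap_normsq {N : ℕ} (x : EuclideanSpace ℝ (Fin N)) :
    lap (fun y => ‖y‖ ^ 2) x = 2 * N := by
  have h1 : ∀ i : Fin N, pd i (fun y : EuclideanSpace ℝ (Fin N) => ‖y‖ ^ 2)
      = fun y => 2 * y i := by
    intro i; funext y; exact pd_normsq i y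
  have h2 : ∀ i : Fin N, pd i (fun y : EuclideanSpace ℝ (Fin N) => 2 * y i) x = 2 := by
    intro i
    unfold pd
    have : HasFDerivAt (fun y : EuclideanSpace ℝ (Fin N) => 2 * y i)
      ((2 : ℝ) • (EuclideanSpace.proj i : EuclideanSpace ℝ (Fin N) →L[ℝ] ℝ)) x :=
      ((EuclideanSpace.proj i : EuclideanSpace ℝ (Fin N) →L[ℝ] ℝ).hasFDerivAt).const_mul 2
    rw [this.fderiv]
    simp
  simp only [lap_eq, h1, h2]
  simp [mul_comm]

/-- Green's identity -/
lemma green {N : ℕ} {f g : EuclideanSpace ℝ (Fin N) → ℝ}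
    (hf : ContDiff ℝ 2 f) (hg : ContDiff ℝ 2 g) (hc : HasCompactSupport g) :
    ∫ x, f x * lap g x = ∫ x, g x * lap f x := by
  have df : Differentiable ℝ f := hf.differentiable (by norm_num)
  have dg : Differentiable ℝ g := hg.differentiable (by norm_num)
  have cpf : ∀ i, ContDiff ℝ 1 (pd i f) := fun i =>
    pd_contDiff (n := 2) (m := 1) i hf le_rfl
  have cpg : ∀ i, ContDiff ℝ 1 (pd i g) := fun i =>
    pd_contDiff (n := 2) (m := 1) i hg le_rfl
  have dpf : ∀ i, Differentiable ℝ (pd i f) := fun i => (cpf i).differentiable (by norm_num)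
  have dpg : ∀ i, Differentiable ℝ (pd i g) := fun i => (cpg i).differentiable (by norm_num)
  have ppf : ∀ i, Continuous (pd i (pd i f)) := fun i =>
    (pd_contDiff (n := 1) (m := 0) i (cpf i) le_rfl).continuous
  have ppg : ∀ i, Continuous (pd i (pd i g)) := fun i =>
    (pd_contDiff (n := 1) (m := 0) i (cpg i) le_rfl).continuous
  have sc : ∀ (i : Fin N) {k : EuclideanSpace ℝ (Fin N) → ℝ}, HasCompactSupport k →
      HasCompactSupport (pd i k) := by
    intro i k hk
    exact hk.fderiv_apply ℝ (EuclideanSpace.single i 1)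
  have I : ∀ {k l : EuclideanSpace ℝ (Fin N) → ℝ}, Continuous k → Continuous l →
      HasCompactSupport l → Integrable (fun x => k x * l x) := by
    intro k l hk hl hs
    exact (hk.mul hl).integrable_of_hasCompactSupport hs.mul_left
  have I' : ∀ {k l : EuclideanSpace ℝ (Fin N) → ℝ}, Continuous k → Continuous l →
      HasCompactSupport k → Integrable (fun x => k x * l x) := by
    intro k l hk hl hs
    exact (hk.mul hl).integrable_of_hasCompactSupport hs.mul_right
  have A : ∀ i, ∫ x, f x * pd i (pd i g) x = ∫ x, g x * pd i (pd i f) x := by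
    intro i
    have e1 : ∫ x, f x * pd i (pd i g) x = - ∫ x, pd i f x * pd i g x := by
      refine integral_mul_fderiv_eq_neg_fderiv_mul_of_integrable ?_ ?_ ?_ (fun x _ => df x)
        (fun x _ => dpg i x)
      · exact I (cpf i).continuous (cpg i).continuous (sc i hc)
      · exact I hf.continuous (ppg i) (sc i (sc i hc))
      · exact I hf.continuous (cpg i).continuous (sc i hc)
    have e2 : ∫ x, g x * pd i (pd i f) x = - ∫ x, pd i g x * pd i f x := by
      refine integral_mul_fderiv_eq_neg_fderiv_mul_of_integrable ?_ ?_ ?_ (fun x _ => dg x)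
        (fun x _ => dpf i x)
      · exact I' (cpg i).continuous (cpf i).continuous (sc i hc)
      · exact I' hg.continuous (ppf i) hc
      · exact I' hg.continuous (cpf i).continuous hc
    rw [e1, e2]
    congr 1
    exact integral_congr_ae (Filter.Eventually.of_forall fun x => mul_comm _ _)
  simp only [lap_eq, Finset.mul_sum]
  rw [integral_finsetSum, integral_finsetSum]
  · exact Finset.sum_congr rfl fun i _ => A i
  · intro i _; exact I' hg.continuous (ppf i) hc
  · intro i _; exact I hf.continuous (ppg i) (sc i (sc i hc))

/-- the weight -/
noncomputable def wt {N : ℕ} (x : EuclideanSpace ℝ (Fin N)) : ℝ := (1 + ‖x‖ ^ 2)⁻¹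

lemma wt_pos {N : ℕ} (x : EuclideanSpace ℝ (Fin N)) : 0 < wt x := by
  unfold wt; positivity

lemma wt_le_one {N : ℕ} (x : EuclideanSpace ℝ (Fin N)) : wt x ≤ 1 := by
  unfold wt
  exact inv_le_one_of_one_le₀ (by nlinarith [sq_nonneg ‖x‖])

lemma normsq_contDiff {N : ℕ} {n : WithTop ℕ∞} :
    ContDiff ℝ n (fun y : EuclideanSpace ℝ (Fin N) => ‖y‖ ^ 2) := contDiff_norm_sq ℝ

lemma wt_contDiff {N : ℕ} {n : WithTop ℕ∞} :
    ContDiff ℝ n (wt : EuclideanSpace ℝ (Fin N) → ℝ) := by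
  unfold wt
  exact (contDiff_const.add normsq_contDiff).inv (fun x => by positivity)

lemma wt_deriv0 (t : ℝ) (ht : 0 ≤ t) :
    HasDerivAt (fun s : ℝ => (1 + s)⁻¹) (-((1 + t) ^ 2)⁻¹) t := by
  have h : HasDerivAt (fun s : ℝ => 1 + s) 1 t := (hasDerivAt_id t).const_add 1
  refine (h.fun_inv (by positivity)).congr_deriv ?_
  field_simp

lemma wt_deriv1 (t : ℝ) (ht : 0 ≤ t) :
    HasDerivAt (fun s : ℝ => -((1 + s) ^ 2)⁻¹) (2 * ((1 + t) ^ 3)⁻¹) t := by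
  have h : HasDerivAt (fun s : ℝ => 1 + s) 1 t := (hasDerivAt_id t).const_add 1
  refine ((h.fun_pow 2).fun_inv (by positivity)).fun_neg.congr_deriv ?_
  field_simp
  norm_num
  ring

lemma wt_gam {N : ℕ} (x : EuclideanSpace ℝ (Fin N)) : gam wt wt x ≤ 4 * wt x ^ 3 := by
  have d : DifferentiableAt ℝ (fun y : EuclideanSpace ℝ (Fin N) => ‖y‖ ^ 2) x :=
    (normsq_contDiff (n := 1)).differentiable (by norm_num) x
  have e : (wt : EuclideanSpace ℝ (Fin N) → ℝ) =
    fun y => (fun s : ℝ => (1 + s)⁻¹) (‖y‖ ^ 2) := rfl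
  rw [e, gam_comp d (wt_deriv0 _ (by positivity)), gam_comm, gam_comp d (wt_deriv0 _ (by positivity)),
    gam_normsq]
  change _ ≤ 4 * ((1 + ‖x‖ ^ 2)⁻¹) ^ 3
  have hs : 0 ≤ ‖x‖ ^ 2 := by positivity
  generalize ‖x‖ ^ 2 = t at hs
  have : -((1 + t) ^ 2)⁻¹ * (-((1 + t) ^ 2)⁻¹ * (4 * t)) = 4 * ((1 + t)⁻¹) ^ 3 * (t / (1 + t)) := by
    field_simp
  rw [this]
  have h1 : t / (1 + t) ≤ 1 := by rw [div_le_one (by positivity)]; linarith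
  exact mul_le_of_le_one_right (by positivity) h1

lemma wt_lap {N : ℕ} (x : EuclideanSpace ℝ (Fin N)) : |lap wt x| ≤ (2 * N + 8) * wt x ^ 2 := by
  have e : (wt : EuclideanSpace ℝ (Fin N) → ℝ) =
    fun y => (fun s : ℝ => (1 + s)⁻¹) (‖y‖ ^ 2) := rfl
  rw [e, lap_comp (G1 := fun s => -((1 + s) ^ 2)⁻¹) (G2 := fun s => 2 * ((1 + s) ^ 3)⁻¹)
    normsq_contDiff (fun x => wt_deriv0 _ (by positivity)) (fun x => wt_deriv1 _ (by positivity)),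
    gam_normsq, lap_normsq]
  change |2 * ((1 + ‖x‖ ^ 2) ^ 3)⁻¹ * (4 * ‖x‖ ^ 2) + -((1 + ‖x‖ ^ 2) ^ 2)⁻¹ * (2 * (N : ℝ))| ≤
    (2 * (N : ℝ) + 8) * ((1 + ‖x‖ ^ 2)⁻¹) ^ 2
  have hs : 0 ≤ ‖x‖ ^ 2 := by positivity
  generalize ‖x‖ ^ 2 = t at hs
  have : 2 * ((1 + t) ^ 3)⁻¹ * (4 * t) + -((1 + t) ^ 2)⁻¹ * (2 * N) =
    (8 * (t / (1 + t)) - 2 * N) * ((1 + t)⁻¹) ^ 2 := by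
    field_simp
    ring
  rw [this]
  rw [abs_mul, abs_of_nonneg (a := ((1 + t)⁻¹) ^ 2) (by positivity)]
  have h1 : t / (1 + t) ≤ 1 := by rw [div_le_one (by positivity)]; linarith
  have h2 : 0 ≤ t / (1 + t) := by positivity
  refine mul_le_mul_of_nonneg_right ?_ (by positivity)
  have hN : (0 : ℝ) ≤ N := by positivity
  rw [abs_le]; constructor <;> linarith

lemma radial_bound {N : ℕ} (G : ℝ → ℝ) (hG : ContDiff ℝ 4 G)
    (h0 : ∀ t, t < 1 → deriv G t = 0) (h2 : ∀ t, 2 < t → deriv G t = 0) :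
    ∃ c : ℝ, 0 ≤ c ∧ ∀ ε : ℝ, 0 < ε → ε ≤ 1 → ∀ x : EuclideanSpace ℝ (Fin N),
      gam (fun y => G (ε * ‖y‖ ^ 2)) (fun y => G (ε * ‖y‖ ^ 2)) x ≤ c * wt x ∧
      |lap (fun y => G (ε * ‖y‖ ^ 2)) x| ≤ c * wt x := by
  have c1 : ContDiff ℝ 3 (deriv G) := by
    have : ContDiff ℝ (3 + 1) G := by norm_num; exact hG
    exact (contDiff_succ_iff_deriv.1 this).2.2
  have c2 : ContDiff ℝ 2 (deriv (deriv G)) := by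
    have : ContDiff ℝ (2 + 1) (deriv G) := by norm_num; exact c1
    exact (contDiff_succ_iff_deriv.1 this).2.2
  have s1 : HasCompactSupport (deriv G) := by
    refine HasCompactSupport.intro (isCompact_Icc (a := (1:ℝ)) (b := 2)) ?_
    intro t ht
    by_contra hne
    apply ht
    constructor
    · by_contra h; exact hne (h0 t (by linarith))
    · by_contra h; exact hne (h2 t (by linarith))
  have s2 : HasCompactSupport (deriv (deriv G)) := s1.deriv
  obtain ⟨A, hA⟩ := (c1.continuous.mul ((continuous_const (y := (1:ℝ))).add continuous_id |>.pow 1)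
      |>.bounded_above_of_compact_support s1.mul_right : ∃ C, ∀ t, ‖_‖ ≤ C)
  obtain ⟨B, hB⟩ := (c2.continuous.mul ((continuous_const (y := (1:ℝ))).add continuous_id |>.pow 2)
      |>.bounded_above_of_compact_support s2.mul_right : ∃ C, ∀ t, ‖_‖ ≤ C)
  have hA0 : 0 ≤ A := (norm_nonneg _).trans (hA 0)
  have hB0 : 0 ≤ B := (norm_nonneg _).trans (hB 0)
  refine ⟨4 * A ^ 2 + 4 * B + 2 * N * A, by positivity, ?_⟩
  intro ε hε hε1 x
  have d : DifferentiableAt ℝ (fun y : EuclideanSpace ℝ (Fin N) => ‖y‖ ^ 2) x :=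
    (normsq_contDiff (n := 1)).differentiable (by norm_num) x
  have hd0 : ∀ t, HasDerivAt (fun s => G (ε * s)) (ε * deriv G (ε * t)) t := by
    intro t
    have h1 : HasDerivAt (fun s : ℝ => ε * s) ε t := by
      simpa using (hasDerivAt_id t).const_mul ε
    have h3 := (hG.differentiable (by norm_num) (ε * t)).hasDerivAt.comp t h1
    rw [mul_comm]; exact h3
  have hd1 : ∀ t, HasDerivAt (fun s => ε * deriv G (ε * s)) (ε ^ 2 * deriv (deriv G) (ε * t)) t := by
    intro t
    have h1 : HasDerivAt (fun s : ℝ => ε * s) ε t := by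
      simpa using (hasDerivAt_id t).const_mul ε
    have h3 := ((c1.differentiable (by norm_num) (ε * t)).hasDerivAt.comp t h1).const_mul ε
    exact h3.congr_deriv (by ring)
  have e : (fun y : EuclideanSpace ℝ (Fin N) => G (ε * ‖y‖ ^ 2)) =
    fun y => (fun s => G (ε * s)) (‖y‖ ^ 2) := rfl
  have E1 : gam (fun y => G (ε * ‖y‖ ^ 2)) (fun y => G (ε * ‖y‖ ^ 2)) x =
      (ε * deriv G (ε * ‖x‖ ^ 2)) * ((ε * deriv G (ε * ‖x‖ ^ 2)) * (4 * ‖x‖ ^ 2)) := by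
    rw [e, gam_comp d (hd0 _), gam_comm, gam_comp d (hd0 _), gam_normsq]
  have E2 : lap (fun y => G (ε * ‖y‖ ^ 2)) x =
      ε ^ 2 * deriv (deriv G) (ε * ‖x‖ ^ 2) * (4 * ‖x‖ ^ 2) +
        ε * deriv G (ε * ‖x‖ ^ 2) * (2 * N) := by
    rw [e, lap_comp (G1 := fun s => ε * deriv G (ε * s))
      (G2 := fun s => ε ^ 2 * deriv (deriv G) (ε * s)) normsq_contDiff
      (fun x => hd0 _) (fun x => hd1 _), gam_normsq, lap_normsq]
  rw [E1, E2]
  have hA' : |deriv G (ε * ‖x‖ ^ 2) * (1 + ε * ‖x‖ ^ 2) ^ 1| ≤ A := hA (ε * ‖x‖ ^ 2)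
  have hB' : |deriv (deriv G) (ε * ‖x‖ ^ 2) * (1 + ε * ‖x‖ ^ 2) ^ 2| ≤ B := hB (ε * ‖x‖ ^ 2)
  clear hA hB E1 E2 e d
  unfold wt
  have hs : 0 ≤ ‖x‖ ^ 2 := by positivity
  generalize ‖x‖ ^ 2 = s at hs hA' hB' ⊢
  generalize deriv (deriv G) (ε * s) = g2 at hA' hB' ⊢
  generalize deriv G (ε * s) = g1 at hA' hB' ⊢
  simp only [id, pow_one, Real.norm_eq_abs, abs_mul, Pi.add_apply, Pi.mul_apply, Pi.pow_apply,
    abs_pow] at hA' hB'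
  have ht : 0 ≤ ε * s := by positivity
  rw [abs_of_nonneg (by positivity : 0 ≤ 1 + ε * s)] at hA' hB'
  rw [← div_eq_mul_inv, le_div_iff₀ (by positivity), le_div_iff₀ (by positivity)]
  have k1 : ε * (1 + s) ≤ 1 + ε * s := by nlinarith
  have k0 : 0 ≤ ε * (1 + s) := by positivity
  -- `|g1| * ε(1+s) ≤ A`
  have a1 : |g1| * (ε * (1 + s)) ≤ A :=
    (mul_le_mul_of_nonneg_left k1 (abs_nonneg _)).trans hA'
  have a2 : |g1| * (ε * s) ≤ A :=
    (mul_le_mul_of_nonneg_left (by linarith) (abs_nonneg _)).trans hA'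
  have b1 : |g2| * ((ε * s) * (ε * (1 + s))) ≤ B := by
    refine (mul_le_mul_of_nonneg_left ?_ (abs_nonneg _)).trans hB'
    rw [sq]; exact mul_le_mul (by linarith) k1 k0 (by linarith)
  have hN : (0 : ℝ) ≤ N := by positivity
  constructor
  · have : ε * g1 * (ε * g1 * (4 * s)) * (1 + s) =
        4 * ((|g1| * (ε * s)) * (|g1| * (ε * (1 + s)))) := by
      have := abs_mul_abs_self g1
      linear_combination (-(4 * ε ^ 2 * s * (1 + s))) * this
    rw [this]
    have := mul_le_mul a2 a1 (by positivity) hA0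
    nlinarith [mul_nonneg hN hA0]
  · have : |ε ^ 2 * g2 * (4 * s) + ε * g1 * (2 * N)| * (1 + s) ≤
        4 * (|g2| * ((ε * s) * (ε * (1 + s)))) + 2 * N * (|g1| * (ε * (1 + s))) := by
      have h := abs_add_le (ε ^ 2 * g2 * (4 * s)) (ε * g1 * (2 * N))
      have h' : |ε ^ 2 * g2 * (4 * s)| + |ε * g1 * (2 * N)| =
          4 * (|g2| * (ε * s * ε)) + 2 * N * (|g1| * ε) := by
        simp only [abs_mul, abs_of_pos hε, abs_of_nonneg hs, abs_of_nonneg hN, abs_pow]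
        norm_num; ring
      calc _ ≤ (4 * (|g2| * (ε * s * ε)) + 2 * N * (|g1| * ε)) * (1 + s) :=
            mul_le_mul_of_nonneg_right (h.trans_eq h') (by positivity)
        _ = _ := by ring
    have h3 : 2 * N * (|g1| * (ε * (1 + s))) ≤ 2 * N * A :=
      mul_le_mul_of_nonneg_left a1 (by positivity)
    nlinarith [sq_nonneg A]

lemma cutoff {N : ℕ} (ρ : ℝ) (hρ : 1 ≤ ρ) :
    ∃ c : ℝ, 0 ≤ c ∧ ∀ R : ℝ, 1 ≤ R → ∃ η : EuclideanSpace ℝ (Fin N) → ℝ,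
      ContDiff ℝ 4 η ∧ HasCompactSupport η ∧ (∀ x, 0 ≤ η x) ∧ (∀ x, η x ≤ 1) ∧
      (∀ x, ‖x‖ ≤ ρ → η x = 0) ∧ (∀ x, 2 * ρ ≤ ‖x‖ → ‖x‖ ≤ R → η x = 1) ∧
      (∀ x, gam η η x ≤ c * wt x) ∧ (∀ x, |lap η x| ≤ c * wt x) := by
  have S4 : ContDiff ℝ 4 smoothTransition := Real.smoothTransition.contDiff (n := 4)
  set G0 : ℝ → ℝ := fun t => smoothTransition (t - 1) with hG0
  set G1 : ℝ → ℝ := fun t => smoothTransition (2 - t) with hG1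
  have C0 : ContDiff ℝ 4 G0 := S4.comp (contDiff_id.sub contDiff_const)
  have C1 : ContDiff ℝ 4 G1 := S4.comp (contDiff_const.sub contDiff_id)
  have dz : ∀ (G : ℝ → ℝ) (k : ℝ) (U : Set ℝ), IsOpen U → (∀ t ∈ U, G t = k) →
      ∀ t ∈ U, deriv G t = 0 := by
    intro G k U hU h t ht
    have : G =ᶠ[nhds t] fun _ => k := by
      filter_upwards [hU.mem_nhds ht] with s hs using h s hs
    rw [this.deriv_eq]; simp
  obtain ⟨c0, hc0, H0⟩ := radial_bound (N := N) G0 C0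
    (dz G0 0 (Set.Iio 1) isOpen_Iio fun t ht =>
      Real.smoothTransition.zero_of_nonpos (by simp at ht; linarith))
    (dz G0 1 (Set.Ioi 2) isOpen_Ioi fun t ht =>
      Real.smoothTransition.one_of_one_le (by simp at ht; linarith))
  obtain ⟨c1, hc1, H1⟩ := radial_bound (N := N) G1 C1
    (dz G1 1 (Set.Iio 1) isOpen_Iio fun t ht =>
      Real.smoothTransition.one_of_one_le (by simp at ht; linarith))
    (dz G1 0 (Set.Ioi 2) isOpen_Ioi fun t ht =>
      Real.smoothTransition.zero_of_nonpos (by simp at ht; linarith))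
  refine ⟨2 * (c0 + c1), by positivity, ?_⟩
  intro R hR
  have inv_le : ∀ r : ℝ, 1 ≤ r → 0 < (r ^ 2)⁻¹ ∧ (r ^ 2)⁻¹ ≤ 1 := by
    intro r hr
    exact ⟨by positivity, inv_le_one_of_one_le₀ (by nlinarith)⟩
  obtain ⟨e0, e0'⟩ := inv_le ρ hρ
  obtain ⟨e1, e1'⟩ := inv_le R hR
  have ρ0 : 0 < ρ := by linarith
  have R0 : 0 < R := by linarith
  set f : EuclideanSpace ℝ (Fin N) → ℝ := fun y => G0 ((ρ ^ 2)⁻¹ * ‖y‖ ^ 2) with hf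
  set g : EuclideanSpace ℝ (Fin N) → ℝ := fun y => G1 ((R ^ 2)⁻¹ * ‖y‖ ^ 2) with hg
  have Cf : ContDiff ℝ 4 f := C0.comp (contDiff_const.mul normsq_contDiff)
  have Cg : ContDiff ℝ 4 g := C1.comp (contDiff_const.mul normsq_contDiff)
  have f0 : ∀ x, 0 ≤ f x := fun x => Real.smoothTransition.nonneg _
  have f1 : ∀ x, f x ≤ 1 := fun x => Real.smoothTransition.le_one _
  have g0 : ∀ x, 0 ≤ g x := fun x => Real.smoothTransition.nonneg _
  have g1 : ∀ x, g x ≤ 1 := fun x => Real.smoothTransition.le_one _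
  refine ⟨fun x => f x * g x, Cf.mul Cg, ?_, fun x => mul_nonneg (f0 x) (g0 x),
    fun x => mul_le_one₀ (f1 x) (g0 x) (g1 x), ?_, ?_, ?_⟩
  · refine HasCompactSupport.intro (isCompact_closedBall (0 : EuclideanSpace ℝ (Fin N)) (2 * R)) ?_
    intro x hx
    have hx : 2 * R < ‖x‖ := by simpa using hx
    have : g x = 0 := by
      refine Real.smoothTransition.zero_of_nonpos ?_
      have : 2 ≤ (R ^ 2)⁻¹ * ‖x‖ ^ 2 := by
        rw [inv_mul_eq_div, le_div_iff₀ (by positivity)]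
        nlinarith
      linarith
    simp [this]
  · intro x hx
    have : f x = 0 := by
      refine Real.smoothTransition.zero_of_nonpos ?_
      have : (ρ ^ 2)⁻¹ * ‖x‖ ^ 2 ≤ 1 := by
        rw [inv_mul_eq_div, div_le_iff₀ (by positivity)]
        nlinarith [norm_nonneg x]
      linarith
    simp [this]
  · intro x hx hx'
    have a1 : f x = 1 := by
      refine Real.smoothTransition.one_of_one_le ?_
      have : 2 ≤ (ρ ^ 2)⁻¹ * ‖x‖ ^ 2 := by
        rw [inv_mul_eq_div, le_div_iff₀ (by positivity)]
        nlinarith [norm_nonneg x]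
      linarith
    have a2 : g x = 1 := by
      refine Real.smoothTransition.one_of_one_le ?_
      have : (R ^ 2)⁻¹ * ‖x‖ ^ 2 ≤ 1 := by
        rw [inv_mul_eq_div, div_le_iff₀ (by positivity)]
        nlinarith [norm_nonneg x]
      linarith
    simp [a1, a2]
  have C2f : ContDiff ℝ 2 f := Cf.of_le (by norm_num)
  have C2g : ContDiff ℝ 2 g := Cg.of_le (by norm_num)
  have df : Differentiable ℝ f := C2f.differentiable (by norm_num)
  have dg : Differentiable ℝ g := C2g.differentiable (by norm_num)
  have key : ∀ x, gam f f x ≤ c0 * wt x ∧ |lap f x| ≤ c0 * wt x ∧ gam g g x ≤ c1 * wt x ∧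
      |lap g x| ≤ c1 * wt x ∧ 2 * |gam f g x| ≤ (c0 + c1) * wt x := by
    intro x
    obtain ⟨h1, h2⟩ := H0 _ e0 e0' x
    obtain ⟨h3, h4⟩ := H1 _ e1 e1' x
    refine ⟨h1, h2, h3, h4, ?_⟩
    have h5 := gam_sq_le f g x
    have n1 := gam_self_nonneg f x
    have n2 := gam_self_nonneg g x
    have : 2 * |gam f g x| ≤ gam f f x + gam g g x := by
      refine abs_le_of_sq_le_sq' ?_ (by positivity) |>.2
      rw [mul_pow, sq_abs]
      nlinarith [sq_nonneg (gam f f x - gam g g x)]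
    have h1' : gam f f x ≤ c0 * wt x := h1
    have h3' : gam g g x ≤ c1 * wt x := h3
    linarith
  refine ⟨fun x => ?_, fun x => ?_⟩
  · obtain ⟨h1, h2, h3, h4, h5⟩ := key x
    rw [gam_mul (df x) (dg x), gam_comm _ g, gam_comm _ f, gam_mul (df x) (dg x),
      gam_mul (df x) (dg x), gam_comm g f]
    have n1 := gam_self_nonneg f x
    have n2 := gam_self_nonneg g x
    have p1 : f x ^ 2 * gam g g x ≤ gam g g x :=
      mul_le_of_le_one_left n2 (pow_le_one₀ (f0 x) (f1 x))
    have p2 : g x ^ 2 * gam f f x ≤ gam f f x :=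
      mul_le_of_le_one_left n1 (pow_le_one₀ (g0 x) (g1 x))
    have p3 : (f x * g x) * gam f g x ≤ |gam f g x| := by
      refine (le_abs_self _).trans ?_
      rw [abs_mul, abs_of_nonneg (mul_nonneg (f0 x) (g0 x))]
      exact mul_le_of_le_one_left (abs_nonneg _) (mul_le_one₀ (f1 x) (g0 x) (g1 x))
    nlinarith
  · obtain ⟨h1, h2, h3, h4, h5⟩ := key x
    rw [lap_mul C2f C2g]
    have p1 : |f x * lap g x| ≤ |lap g x| := by
      rw [abs_mul, abs_of_nonneg (f0 x)]
      exact mul_le_of_le_one_left (abs_nonneg _) (f1 x)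
    have p2 : |g x * lap f x| ≤ |lap f x| := by
      rw [abs_mul, abs_of_nonneg (g0 x)]
      exact mul_le_of_le_one_left (abs_nonneg _) (g1 x)
    have p3 : |2 * gam f g x| = 2 * |gam f g x| := by rw [abs_mul]; norm_num
    have := abs_add_le (f x * lap g x + 2 * gam f g x) (g x * lap f x)
    have := abs_add_le (f x * lap g x) (2 * gam f g x)
    linarith

lemma alg_ineq (k M : ℝ) (hk : 0 < k) (hM : 0 ≤ M) : ∃ μ C : ℝ, 0 ≤ μ ∧ 0 ≤ C ∧
    ∀ X Y Z q V D g : ℝ, Y ^ 2 ≤ M * g → |Z| ≤ M * |q| → |V| ≤ M * |X * q| → |D| ≤ M * q ^ 2 →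
    -k * X ^ 2 + 4 * Y ^ 2 + Z ^ 2 + 4 * (Y * Z) - 4 * k * (X * Y) - 2 * k * (X * Z)
      - 2 * (1 + k) * V - μ * (X * q) - μ * g + μ / 2 * D ≤ -(k / 2) * X ^ 2 + C * q ^ 2 := by
  set μ := (6 + 32 * k) * M with hμ
  have hμ0 : 0 ≤ μ := by positivity
  have young : ∀ A X q : ℝ, A * |X * q| ≤ k / 8 * X ^ 2 + 2 * A ^ 2 / k * q ^ 2 := by
    intro A X q
    have h : 0 ≤ (k * |X| - 4 * A * |q|) ^ 2 := sq_nonneg _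
    have e : k / 8 * X ^ 2 + 2 * A ^ 2 / k * q ^ 2 - A * |X * q| =
        (k * |X| - 4 * A * |q|) ^ 2 / (8 * k) := by
      rw [abs_mul, ← sq_abs X, ← sq_abs q]
      field_simp
      ring
    have : 0 ≤ (k * |X| - 4 * A * |q|) ^ 2 / (8 * k) := by positivity
    linarith
  refine ⟨μ, (3 + 8 * k) * M ^ 2 + 2 * (2 * (1 + k) * M) ^ 2 / k + 2 * μ ^ 2 / k + μ / 2 * M,
    hμ0, by positivity, ?_⟩
  intro X Y Z q V D g hY hZ hV hD
  have hZ2 : Z ^ 2 ≤ M ^ 2 * q ^ 2 := by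
    rw [← mul_pow, ← sq_abs Z, ← sq_abs (M * q), abs_mul, abs_of_nonneg hM]
    exact pow_le_pow_left₀ (abs_nonneg _) hZ 2
  have hV2 : -V ≤ M * |X * q| := (neg_le_abs V).trans hV
  have t1 := young (2 * (1 + k) * M) X q
  have t2 := young μ X q
  have t3 : -(μ * (X * q)) ≤ μ * |X * q| := by
    rw [← mul_neg]; exact mul_le_mul_of_nonneg_left (neg_le_abs _) hμ0
  have t4 : μ / 2 * D ≤ μ / 2 * (M * q ^ 2) :=
    mul_le_mul_of_nonneg_left ((le_abs_self D).trans hD) (by positivity)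
  have t5 : 2 * (1 + k) * (-V) ≤ 2 * (1 + k) * (M * |X * q|) :=
    mul_le_mul_of_nonneg_left hV2 (by positivity)
  have t6 : -(4 * k * (X * Y)) ≤ k / 8 * X ^ 2 + 32 * k * Y ^ 2 := by
    nlinarith [mul_nonneg hk.le (sq_nonneg (X + 16 * Y))]
  have t7 : -(2 * k * (X * Z)) ≤ k / 8 * X ^ 2 + 8 * k * Z ^ 2 := by
    nlinarith [mul_nonneg hk.le (sq_nonneg (X + 8 * Z))]
  have t8 : 4 * (Y * Z) ≤ 2 * Y ^ 2 + 2 * Z ^ 2 := by nlinarith [sq_nonneg (Y - Z)]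
  have t9 : (6 + 32 * k) * Y ^ 2 ≤ μ * g := by
    rw [hμ, mul_assoc]; exact mul_le_mul_of_nonneg_left hY (by positivity)
  have t10 : (3 + 8 * k) * Z ^ 2 ≤ (3 + 8 * k) * (M ^ 2 * q ^ 2) :=
    mul_le_mul_of_nonneg_left hZ2 (by positivity)
  linarith

lemma young_pt (k C p a : ℝ) (n : ℕ) (hk : 0 < k) (hC : 0 ≤ C) (hp : 1 < p) (ha : 0 ≤ a)
    (hn : 4 ≤ n * (p - 1)) : ∃ C' : ℝ, 0 ≤ C' ∧ ∀ r u h w : ℝ, 1 ≤ r → 0 < u → 0 ≤ h → h ≤ 1 →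
    w = (1 + r ^ 2)⁻¹ →
    C * (u * h ^ n * w) ^ 2 ≤ k * (r ^ a * u ^ (p + 1) * (h ^ (n + 2)) ^ 2) +
      C' * w ^ ((a + 2 * p + 2) / (p - 1)) := by
  have hp1 : 0 < p - 1 := by linarith
  set d : ℝ := (1 / 2 : ℝ) ^ (a / 2) with hd
  have d0 : 0 < d := by positivity
  set C0 := C / (k * d) with hC0
  have C00 : 0 ≤ C0 := by positivity
  refine ⟨C * C0 ^ (2 / (p - 1)), by positivity, ?_⟩
  intro r u h w hr hu h0 h1 hw
  have w0 : 0 < w := by rw [hw]; positivity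
  have r0 : 0 < r := by linarith
  rcases h0.eq_or_lt with h0 | h0
  · have hn0 : n ≠ 0 := by rintro rfl; norm_num at hn
    rw [← h0]
    simp only [zero_pow hn0, mul_zero, zero_mul]
    simp only [ne_eq, OfNat.ofNat_ne_zero, not_false_eq_true, zero_pow, mul_zero,
      Nat.add_eq_zero_iff, and_false, zero_add]
    positivity
  set t := u * h ^ n * w with ht
  have t0 : 0 < t := by positivity
  set γ := a / 2 + p + 1 with hγ
  have claim : d * (w ^ (-γ) * t ^ (p + 1)) ≤ r ^ a * u ^ (p + 1) * (h ^ (n + 2)) ^ 2 := by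
    have e1 : w ^ (-γ) * t ^ (p + 1) = w ^ (-(a / 2)) * (u ^ (p + 1) * h ^ (n * (p + 1))) := by
      rw [ht, mul_rpow (by positivity) w0.le, mul_rpow hu.le (by positivity), ← rpow_natCast h n,
        ← rpow_mul h0.le]
      have : w ^ (-γ) * w ^ (p + 1) = w ^ (-(a / 2)) := by
        rw [← rpow_add w0]; congr 1; rw [hγ]; ring
      rw [← this]; ring
    have e2 : d * w ^ (-(a / 2)) ≤ r ^ a := by
      have : w ^ (-(a / 2)) = (1 + r ^ 2) ^ (a / 2) := by
        rw [hw, inv_rpow (by positivity), rpow_neg (by positivity), inv_inv]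
      rw [this, hd, ← mul_rpow (by norm_num) (by positivity)]
      have : r ^ a = (r ^ 2) ^ (a / 2) := by
        rw [← rpow_natCast r 2, ← rpow_mul r0.le]; congr 1; push_cast; ring
      rw [this]
      exact rpow_le_rpow (by positivity) (by nlinarith) (by positivity)
    have e3 : h ^ ((n : ℝ) * (p + 1)) ≤ (h ^ (n + 2)) ^ 2 := by
      rw [← pow_mul, ← rpow_natCast h]
      refine rpow_le_rpow_of_exponent_ge h0 h1 ?_
      push_cast
      nlinarith
    rw [e1, ← mul_assoc, mul_assoc (r ^ a)]
    refine mul_le_mul e2 ?_ (by positivity) (by positivity)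
    exact mul_le_mul_of_nonneg_left e3 (by positivity)
  have pos2 : 0 ≤ C * C0 ^ (2 / (p - 1)) * w ^ ((a + 2 * p + 2) / (p - 1)) := by positivity
  have tt : t ^ (p + 1) = t ^ (p - 1) * t ^ 2 := by
    rw [← rpow_natCast t 2, ← rpow_add t0]; congr 1; push_cast; ring
  have claim2 := mul_le_mul_of_nonneg_left claim hk.le
  by_cases hcase : C ≤ k * d * (w ^ (-γ) * t ^ (p - 1))
  · have := mul_le_mul_of_nonneg_right hcase (sq_nonneg t)
    rw [tt] at claim2
    linarith
  · push Not at hcase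
    have h3 : t ^ (p - 1) ≤ C0 * w ^ γ := by
      rw [hC0, div_mul_eq_mul_div, le_div_iff₀ (by positivity)]
      have := mul_le_mul_of_nonneg_right hcase.le (rpow_nonneg w0.le γ)
      rw [rpow_neg w0.le] at this
      have e : k * d * ((w ^ γ)⁻¹ * t ^ (p - 1)) * w ^ γ = t ^ (p - 1) * (k * d) := by
        have : w ^ γ ≠ 0 := (rpow_pos_of_pos w0 γ).ne'
        field_simp
      linarith
    have h4 : t ^ 2 ≤ C0 ^ (2 / (p - 1)) * w ^ ((a + 2 * p + 2) / (p - 1)) := by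
      have e : t ^ 2 = (t ^ (p - 1)) ^ (2 / (p - 1)) := by
        rw [← rpow_mul t0.le, ← rpow_natCast t 2]; congr 1; push_cast; field_simp
      rw [e]
      refine (rpow_le_rpow (by positivity) h3 (by positivity)).trans_eq ?_
      rw [mul_rpow C00 (by positivity), ← rpow_mul w0.le]
      congr 2
      rw [hγ]; field_simp
    have h5 := mul_le_mul_of_nonneg_left h4 hC
    have h6 : 0 ≤ k * (r ^ a * u ^ (p + 1) * (h ^ (n + 2)) ^ 2) := by positivity
    linarith

lemma lap_support {N : ℕ} {g : EuclideanSpace ℝ (Fin N) → ℝ} (hc : HasCompactSupport g) :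
    HasCompactSupport (lap g) := by
  refine HasCompactSupport.intro hc ?_
  intro x hx
  rw [lap_eq]
  refine Finset.sum_eq_zero fun i _ => ?_
  have h1 : ∀ f : EuclideanSpace ℝ (Fin N) → ℝ, tsupport (pd i f) ⊆ tsupport f := fun f =>
    tsupport_fderiv_apply_subset ℝ (EuclideanSpace.single i 1)
  exact image_eq_zero_of_notMem_tsupport fun h => hx (h1 _ (h1 _ h))

lemma pow_formulas {N : ℕ} (j : ℕ) {η : EuclideanSpace ℝ (Fin N) → ℝ} (hη : ContDiff ℝ 2 η)
    (x : EuclideanSpace ℝ (Fin N)) :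
    (∀ f, gam f (fun y => η y ^ (j + 2)) x = ((j : ℝ) + 2) * η x ^ (j + 1) * gam f η x) ∧
    lap (fun y => η y ^ (j + 2)) x = ((j : ℝ) + 2) * (j + 1) * η x ^ j * gam η η x +
      ((j : ℝ) + 2) * η x ^ (j + 1) * lap η x := by
  have d0 : ∀ t : ℝ, HasDerivAt (fun s : ℝ => s ^ (j + 2)) (((j : ℝ) + 2) * t ^ (j + 1)) t := by
    intro t
    refine (hasDerivAt_pow (j + 2) t).congr_deriv ?_
    push_cast; rfl
  have d1 : ∀ t : ℝ, HasDerivAt (fun s : ℝ => ((j : ℝ) + 2) * s ^ (j + 1))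
      (((j : ℝ) + 2) * (j + 1) * t ^ j) t := by
    intro t
    refine ((hasDerivAt_pow (j + 1) t).const_mul ((j : ℝ) + 2)).congr_deriv ?_
    push_cast; ring
  constructor
  · intro f
    exact gam_comp (G := fun s => s ^ (j + 2)) (hη.differentiable (by norm_num) x) (d0 _)
  · exact lap_comp (G := fun s => s ^ (j + 2)) (G1 := fun s => ((j : ℝ) + 2) * s ^ (j + 1))
      (G2 := fun s => ((j : ℝ) + 2) * (j + 1) * s ^ j) hη (fun x => d0 _) (fun x => d1 _) x

/-- pointwise estimates for the cutoff powers -/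
lemma cutoff_pow (N n : ℕ) (c : ℝ) (hc : 0 ≤ c) : ∃ M : ℝ, 0 ≤ M ∧
    ∀ η : EuclideanSpace ℝ (Fin N) → ℝ, ContDiff ℝ 2 η → (∀ x, 0 ≤ η x) → (∀ x, η x ≤ 1) →
      (∀ x, gam η η x ≤ c * wt x) → (∀ x, |lap η x| ≤ c * wt x) → ∀ x,
      gam (fun y => η y ^ (n + 2)) (fun y => η y ^ (n + 2)) x ≤ M * (η x ^ (2 * n + 2) * wt x) ∧
      |lap (fun y => η y ^ (n + 2)) x| ≤ M * (η x ^ n * wt x) ∧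
      |lap (fun y => η y ^ (2 * n + 2) * wt y) x| ≤ M * (η x ^ n * wt x) ^ 2 := by
  set M1 := ((n : ℝ) + 2) ^ 2 * c with hM1
  set M3 := (2 * (n : ℝ) + 2) * (2 * n + 1) * c + (2 * (n : ℝ) + 2) * c +
    2 * (2 * (n : ℝ) + 2) * (c + 1) + (2 * N + 8) with hM3
  refine ⟨M1 + M3, by positivity, ?_⟩
  have M10 : 0 ≤ M1 := by positivity
  have M30 : 0 ≤ M3 := by positivity
  intro η hη h0 h1 hg hl x
  obtain ⟨P1, P2⟩ := pow_formulas n hη x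
  obtain ⟨Q1, Q2⟩ := pow_formulas (2 * n) hη x
  push_cast at Q1 Q2
  have gx := hg x
  have lx := hl x
  have w0 := wt_pos x
  have h0x := h0 x
  have h1x := h1 x
  have gn := gam_self_nonneg η x
  have hle : η x ^ (n + 1) ≤ η x ^ n := pow_le_pow_of_le_one h0x h1x (Nat.le_succ n)
  have hle1 : η x ^ (2 * n + 1) ≤ η x ^ (2 * n) := pow_le_pow_of_le_one h0x h1x (Nat.le_succ _)
  have hle2 : η x ^ (2 * n + 2) ≤ η x ^ (2 * n) := pow_le_pow_of_le_one h0x h1x (by omega)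
  have hn : 0 ≤ η x ^ n := by positivity
  have hn1 : 0 ≤ η x ^ (n + 1) := by positivity
  have h2n : 0 ≤ η x ^ (2 * n) := by positivity
  refine ⟨?_, ?_, ?_⟩
  · rw [P1, gam_comm, P1]
    have e : ((n : ℝ) + 2) * η x ^ (n + 1) * (((n : ℝ) + 2) * η x ^ (n + 1) * gam η η x) =
      ((n : ℝ) + 2) ^ 2 * η x ^ (2 * n + 2) * gam η η x := by ring
    rw [e]
    calc _ ≤ ((n : ℝ) + 2) ^ 2 * η x ^ (2 * n + 2) * (c * wt x) :=
          mul_le_mul_of_nonneg_left gx (by positivity)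
      _ = M1 * (η x ^ (2 * n + 2) * wt x) := by rw [hM1]; ring
      _ ≤ _ := mul_le_mul_of_nonneg_right (by linarith) (by positivity)
  · rw [P2]
    have a1 : |((n : ℝ) + 2) * (n + 1) * η x ^ n * gam η η x| ≤
        ((n : ℝ) + 2) * (n + 1) * η x ^ n * (c * wt x) := by
      rw [abs_of_nonneg (by positivity)]
      exact mul_le_mul_of_nonneg_left gx (by positivity)
    have a2 : |((n : ℝ) + 2) * η x ^ (n + 1) * lap η x| ≤
        ((n : ℝ) + 2) * η x ^ n * (c * wt x) := by
      rw [abs_mul, abs_of_nonneg (a := ((n : ℝ) + 2) * η x ^ (n + 1)) (by positivity)]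
      exact mul_le_mul (mul_le_mul_of_nonneg_left hle (by positivity)) lx (abs_nonneg _)
        (by positivity)
    calc _ ≤ _ := abs_add_le _ _
      _ ≤ M1 * (η x ^ n * wt x) := by
        rw [hM1]; refine (add_le_add a1 a2).trans_eq ?_; ring
      _ ≤ _ := mul_le_mul_of_nonneg_right (by linarith) (by positivity)
  · rw [lap_mul (hη.pow _) wt_contDiff, Q2, gam_comm _ wt, Q1]
    have gw : |gam wt η x| ≤ (c + 1) * wt x ^ 2 := by
      refine abs_le_of_sq_le_sq ?_ (by positivity)
      calc gam wt η x ^ 2 ≤ gam wt wt x * gam η η x := gam_sq_le _ _ _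
        _ ≤ (4 * wt x ^ 3) * (c * wt x) := mul_le_mul (wt_gam x) gx gn (by positivity)
        _ = 4 * c * wt x ^ 4 := by ring
        _ ≤ (c + 1) ^ 2 * wt x ^ 4 :=
          mul_le_mul_of_nonneg_right (by nlinarith [sq_nonneg (c - 1)]) (by positivity)
        _ = _ := by ring
    have a0 : |η x ^ (2 * n + 2) * lap wt x| ≤ η x ^ (2 * n) * ((2 * N + 8) * wt x ^ 2) := by
      rw [abs_mul, abs_of_nonneg (a := η x ^ (2 * n + 2)) (by positivity)]
      exact mul_le_mul hle2 (wt_lap x) (abs_nonneg _) h2n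
    have a1 : |2 * ((2 * (n : ℝ) + 2) * η x ^ (2 * n + 1) * gam wt η x)| ≤
        2 * ((2 * (n : ℝ) + 2) * η x ^ (2 * n) * ((c + 1) * wt x ^ 2)) := by
      rw [abs_mul, abs_mul, abs_of_nonneg (a := (2 * (n : ℝ) + 2) * η x ^ (2 * n + 1))
        (by positivity), abs_of_nonneg (a := (2 : ℝ)) (by norm_num)]
      refine mul_le_mul_of_nonneg_left ?_ (by norm_num)
      exact mul_le_mul (mul_le_mul_of_nonneg_left hle1 (by positivity)) gw (abs_nonneg _)
        (by positivity)
    have a2 : |(2 * (n : ℝ) + 2) * (2 * n + 1) * η x ^ (2 * n) * gam η η x| ≤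
        (2 * (n : ℝ) + 2) * (2 * n + 1) * η x ^ (2 * n) * (c * wt x) := by
      rw [abs_of_nonneg (by positivity)]
      exact mul_le_mul_of_nonneg_left gx (by positivity)
    have a3 : |(2 * (n : ℝ) + 2) * η x ^ (2 * n + 1) * lap η x| ≤
        (2 * (n : ℝ) + 2) * η x ^ (2 * n) * (c * wt x) := by
      rw [abs_mul, abs_of_nonneg (a := (2 * (n : ℝ) + 2) * η x ^ (2 * n + 1)) (by positivity)]
      exact mul_le_mul (mul_le_mul_of_nonneg_left hle1 (by positivity)) lx (abs_nonneg _)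
        (by positivity)
    have a4 := mul_le_mul_of_nonneg_left ((abs_add_le _ _).trans (add_le_add a2 a3)) w0.le
    rw [← abs_of_pos w0, ← abs_mul, abs_of_pos w0] at a4
    refine ((abs_add_le _ _).trans (add_le_add ((abs_add_le _ _).trans
      (add_le_add a0 a1)) a4)).trans ?_
    calc _ = M3 * (η x ^ n * wt x) ^ 2 := by rw [hM3]; ring
      _ ≤ _ := mul_le_mul_of_nonneg_right (by linarith) (by positivity)

lemma core {N : ℕ} (a p : ℝ) (ha : 0 ≤ a) (hp : 1 < p)
    (hs : (N : ℝ) < 2 * ((a + 2 * p + 2) / (p - 1)))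
    (u : EuclideanSpace ℝ (Fin N) → ℝ)
    (hu : ContDiff ℝ 4 u) (hupos : ∀ x, 0 < u x)
    (hequ : ∀ x, lap (lap u) x = ‖x‖ ^ a * u x ^ p)
    (K : Set (EuclideanSpace ℝ (Fin N)))
    (hstable : ∀ φ : EuclideanSpace ℝ (Fin N) → ℝ,
      ContDiff ℝ 4 φ → HasCompactSupport φ → Disjoint (tsupport φ) K →
      0 ≤ (∫ x, (lap φ x) ^ 2) - p * ∫ x, ‖x‖ ^ a * u x ^ (p - 1) * φ x ^ 2)
    (n : ℕ) (hn : 4 ≤ n * (p - 1)) (c ρ : ℝ) (hc : 0 ≤ c) (hρ : 1 ≤ ρ)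
    (hKρ : K ⊆ ball 0 ρ) :
    ∃ I : ℝ, ∀ η : EuclideanSpace ℝ (Fin N) → ℝ,
      ContDiff ℝ 4 η → HasCompactSupport η → (∀ x, 0 ≤ η x) → (∀ x, η x ≤ 1) →
      (∀ x, ‖x‖ ≤ ρ → η x = 0) → (∀ x, gam η η x ≤ c * wt x) → (∀ x, |lap η x| ≤ c * wt x) →
      ∫ x, ((lap u x) ^ 2 + ‖x‖ ^ a * u x ^ (p + 1)) * (η x ^ (n + 2)) ^ 2 ≤ I := by
  set k := (p - 1) / 2 with hk
  have k0 : 0 < k := by rw [hk]; linarith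
  obtain ⟨M, hM, HM⟩ := cutoff_pow N n c hc
  obtain ⟨μ, C, hμ, hC, Halg⟩ := alg_ineq k M k0 hM
  obtain ⟨C', hC', Hy⟩ := young_pt (k / 2) C p a n (by positivity) hC hp ha hn
  have hn0 : n ≠ 0 := by rintro rfl; norm_num at hn
  set s := (a + 2 * p + 2) / (p - 1) with hsdef
  set F : EuclideanSpace ℝ (Fin N) → ℝ := fun x => wt x ^ s with hF
  have hFi : Integrable F := by
    have := integrable_rpow_neg_one_add_norm_sq (E := EuclideanSpace ℝ (Fin N)) (μ := volume)
      (r := 2 * s) (by simpa using hs)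
    refine this.congr (Filter.Eventually.of_forall fun x => ?_)
    simp only [hF, wt]
    rw [inv_rpow (by positivity), ← rpow_neg (by positivity)]
    congr 1; ring
  refine ⟨(C' * ∫ x, F x) / (k / 2), ?_⟩
  intro η hη hηc h0 h1 hz hg hl
  have hη2 : ContDiff ℝ 2 η := hη.of_le (by norm_num)
  have hu2 : ContDiff ℝ 2 u := hu.of_le (by norm_num)
  have hL2 : ContDiff ℝ 2 (lap u) := lap_contDiff (n := 4) (m := 2) hu le_rfl
  have du : Differentiable ℝ u := hu2.differentiable (by norm_num)
  set ψ : EuclideanSpace ℝ (Fin N) → ℝ := fun y => η y ^ (n + 2) with hψ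
  set χ : EuclideanSpace ℝ (Fin N) → ℝ := fun y => η y ^ (2 * n + 2) * wt y with hχ
  have hψ4 : ContDiff ℝ 4 ψ := hη.pow _
  have hψ2 : ContDiff ℝ 2 ψ := hη2.pow _
  have hχ2 : ContDiff ℝ 2 χ := (hη2.pow _).mul wt_contDiff
  have dψ : Differentiable ℝ ψ := hψ2.differentiable (by norm_num)
  have zz : ∀ {f : EuclideanSpace ℝ (Fin N) → ℝ}, (∀ x, η x = 0 → f x = 0) →
      HasCompactSupport f := by
    intro f hf
    refine HasCompactSupport.intro hηc fun x hx => hf x ?_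
    exact image_eq_zero_of_notMem_tsupport hx
  have hψc : HasCompactSupport ψ := zz fun x hx => by simp [hψ, hx]
  have hχc : HasCompactSupport χ := zz fun x hx => by simp [hχ, hx]
  set φ : EuclideanSpace ℝ (Fin N) → ℝ := fun y => u y * ψ y with hφ
  have hφ4 : ContDiff ℝ 4 φ := hu.mul hψ4
  have hφ2 : ContDiff ℝ 2 φ := hu2.mul hψ2
  have hφc : HasCompactSupport φ := hψc.mul_left
  set θ : EuclideanSpace ℝ (Fin N) → ℝ := fun y => u y * (ψ y * ψ y) with hθ
  have hθ2 : ContDiff ℝ 2 θ := hu2.mul (hψ2.mul hψ2)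
  have hθc : HasCompactSupport θ := (hψc.mul_left (f := ψ)).mul_left
  have huu : ContDiff ℝ 2 (fun y => u y * u y) := hu2.mul hu2
  have hdisj : Disjoint (tsupport φ) K := by
    have hsub : tsupport φ ⊆ (ball 0 ρ)ᶜ := by
      refine closure_minimal ?_ isOpen_ball.isClosed_compl
      intro x hx hxb
      apply hx
      have : ‖x‖ ≤ ρ := by simpa using (mem_ball_zero_iff.1 hxb).le
      simp [hφ, hψ, hz x this]
    exact Set.disjoint_of_subset hsub hKρ disjoint_compl_left
  have S := hstable φ hφ4 hφc hdisj
  have G1 := green hL2 hθ2 hθc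
  have G2 := green huu hχ2 hχc
  -- continuity
  have cu : Continuous u := hu.continuous
  have cna : Continuous fun x : EuclideanSpace ℝ (Fin N) => ‖x‖ ^ a :=
    continuous_norm.rpow_const fun x => Or.inr ha
  have cup : ∀ r : ℝ, Continuous fun x => u x ^ r := fun r =>
    cu.rpow_const fun x => Or.inl (hupos x).ne'
  have cψ := hψ2.continuous
  have cφ := hφ2.continuous
  have cθ := hθ2.continuous
  have cχ := hχ2.continuous
  have cL := hL2.continuous
  have clφ := lap_continuous hφ2
  have clθ := lap_continuous hθ2
  have clχ := lap_continuous hχ2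
  have clL := lap_continuous hL2
  have cluu := lap_continuous huu
  have i1 : Integrable fun x => (lap φ x) ^ 2 := by
    refine (clφ.pow 2).integrable_of_hasCompactSupport ?_
    have := (lap_support hφc).mul_left (f := lap φ)
    simpa [sq] using this
  have i2 : Integrable fun x => ‖x‖ ^ a * u x ^ (p - 1) * φ x ^ 2 := by
    refine ((cna.mul (cup _)).mul (cφ.pow 2)).integrable_of_hasCompactSupport ?_
    exact zz fun x hx => by simp [hφ, hψ, hx]
  have i3 : Integrable fun x => lap u x * lap θ x :=
    (cL.mul clθ).integrable_of_hasCompactSupport (lap_support hθc).mul_left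
  have i4 : Integrable fun x => θ x * lap (lap u) x :=
    (cθ.mul clL).integrable_of_hasCompactSupport hθc.mul_right
  have i5 : Integrable fun x => u x * u x * lap χ x :=
    ((cu.mul cu).mul clχ).integrable_of_hasCompactSupport (lap_support hχc).mul_left
  have i6 : Integrable fun x => χ x * lap (fun y => u y * u y) x :=
    (cχ.mul cluu).integrable_of_hasCompactSupport hχc.mul_right
  have i7 : Integrable fun x => ((lap u x) ^ 2 + ‖x‖ ^ a * u x ^ (p + 1)) * (ψ x) ^ 2 := by
    refine ((((cL.pow 2)).add (cna.mul (cup _))).mul (cψ.pow 2)).integrable_of_hasCompactSupport ?_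
    exact zz fun x hx => by simp [hψ, hx]
  have pt : ∀ x, ((lap φ x) ^ 2 - p * (‖x‖ ^ a * u x ^ (p - 1) * φ x ^ 2)) +
      ((1 + k) * (θ x * lap (lap u) x - lap u x * lap θ x) +
      μ / 2 * (u x * u x * lap χ x - χ x * lap (fun y => u y * u y) x)) ≤
      C' * F x - k / 2 * (((lap u x) ^ 2 + ‖x‖ ^ a * u x ^ (p + 1)) * (ψ x) ^ 2) := by
    intro x
    obtain ⟨B1, B2, B3⟩ := HM η hη2 h0 h1 hg hl x
    have ux := hupos x
    have wx := wt_pos x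
    have hx0 := h0 x
    have E1 : lap φ x = u x * lap ψ x + 2 * gam u ψ x + ψ x * lap u x := lap_mul hu2 hψ2 x
    have E2 : lap θ x = u x * (ψ x * lap ψ x + 2 * gam ψ ψ x + ψ x * lap ψ x) +
        2 * (ψ x * gam u ψ x + ψ x * gam u ψ x) + ψ x * ψ x * lap u x := by
      rw [hθ, lap_mul hu2 (hψ2.mul hψ2), lap_mul hψ2 hψ2, gam_mul (dψ x) (dψ x)]
    have E3 : lap (fun y => u y * u y) x = u x * lap u x + 2 * gam u u x + u x * lap u x :=
      lap_mul hu2 hu2 x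
    have E4 : θ x * lap (lap u) x = ‖x‖ ^ a * u x ^ (p + 1) * ψ x ^ 2 := by
      rw [hequ, rpow_add_one ux.ne']; simp only [hθ]; ring
    have E5 : ‖x‖ ^ a * u x ^ (p - 1) * φ x ^ 2 = ‖x‖ ^ a * u x ^ (p + 1) * ψ x ^ 2 := by
      have : u x ^ (p + 1) = u x ^ (p - 1) * u x ^ 2 := by
        rw [← rpow_natCast (u x) 2, ← rpow_add ux]; congr 1; push_cast; ring
      rw [this]; simp only [hφ]; ring
    have Hyx : C * (u x * η x ^ n * wt x) ^ 2 ≤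
        k / 2 * (‖x‖ ^ a * u x ^ (p + 1) * (ψ x) ^ 2) + C' * F x := by
      rcases le_total ‖x‖ ρ with hxr | hxr
      · have := hz x hxr
        simp only [hψ, this, zero_pow hn0]
        have : 0 ≤ C' * F x := mul_nonneg hC' (rpow_nonneg wx.le _)
        simpa using this
      · exact Hy ‖x‖ (u x) (η x) (wt x) (hρ.trans hxr) ux (h0 x) (h1 x) rfl
    have A := Halg (ψ x * lap u x) (gam u ψ x) (u x * lap ψ x) (u x * η x ^ n * wt x)
      (u x * lap u x * gam ψ ψ x) (u x * u x * lap χ x) (gam u u x * χ x) ?_ ?_ ?_ ?_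
    · have E6 : χ x * (u x * lap u x) = ψ x * lap u x * (u x * η x ^ n * wt x) := by
        simp only [hχ, hψ]; ring
      rw [E1, E2, E3, E4, E5]
      have hpk : p = 1 + 2 * k := by rw [hk]; ring
      generalize hee : ‖x‖ ^ a * u x ^ (p + 1) = ee at Hyx ⊢
      rw [hpk]
      have E7 := congrArg (fun z => μ * z) E6
      linear_combination A + Hyx + (-1 : ℝ) * E7
    · calc gam u ψ x ^ 2 ≤ gam u u x * gam ψ ψ x := gam_sq_le _ _ _
        _ ≤ gam u u x * (M * χ x) := mul_le_mul_of_nonneg_left B1 (gam_self_nonneg _ _)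
        _ = _ := by ring
    · rw [abs_mul, abs_of_pos ux, abs_of_nonneg (a := u x * η x ^ n * wt x) (by positivity)]
      calc _ ≤ u x * (M * (η x ^ n * wt x)) := mul_le_mul_of_nonneg_left B2 ux.le
        _ = _ := by ring
    · have e : ψ x * lap u x * (u x * η x ^ n * wt x) = u x * lap u x * (η x ^ (2 * n + 2) * wt x) := by
        simp only [hψ]; ring
      rw [e, abs_mul, abs_mul (u x * lap u x), abs_of_nonneg (gam_self_nonneg ψ x),
        abs_of_nonneg (a := η x ^ (2 * n + 2) * wt x) (by positivity)]
      calc _ ≤ |u x * lap u x| * (M * (η x ^ (2 * n + 2) * wt x)) :=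
            mul_le_mul_of_nonneg_left B1 (abs_nonneg _)
        _ = _ := by ring
    · rw [abs_mul, abs_of_pos (a := u x * u x) (by positivity)]
      calc _ ≤ u x * u x * (M * (η x ^ n * wt x) ^ 2) :=
            mul_le_mul_of_nonneg_left B3 (by positivity)
        _ = _ := by ring
  have J1 := i1.sub (i2.const_mul p)
  have J2 := (i4.sub i3).const_mul (1 + k)
  have J3 := (i5.sub i6).const_mul (μ / 2)
  have mono := integral_mono (J1.add (J2.add J3)) ((hFi.const_mul C').sub (i7.const_mul (k / 2))) pt
  have lhs : ∫ x, ((lap φ x) ^ 2 - p * (‖x‖ ^ a * u x ^ (p - 1) * φ x ^ 2)) +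
      ((1 + k) * (θ x * lap (lap u) x - lap u x * lap θ x) +
      μ / 2 * (u x * u x * lap χ x - χ x * lap (fun y => u y * u y) x)) =
      (∫ x, (lap φ x) ^ 2) - p * ∫ x, ‖x‖ ^ a * u x ^ (p - 1) * φ x ^ 2 := by
    have q1 := integral_add J1 (J2.add J3)
    have q2 := integral_add J2 J3
    have q3 := integral_sub i1 (i2.const_mul p)
    have q4 := integral_sub i4 i3
    have q5 := integral_sub i5 i6
    simp only [Pi.add_apply, Pi.sub_apply, integral_const_mul] at q1 q2 q3 q4 q5
    rw [q1, q2, q3, q4, q5, G1, G2]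
    ring
  have rhs : ∫ x, C' * F x - k / 2 * (((lap u x) ^ 2 + ‖x‖ ^ a * u x ^ (p + 1)) * (ψ x) ^ 2) =
      C' * (∫ x, F x) - k / 2 * ∫ x, ((lap u x) ^ 2 + ‖x‖ ^ a * u x ^ (p + 1)) * (ψ x) ^ 2 := by
    rw [integral_sub (hFi.const_mul C') (i7.const_mul (k / 2)), integral_const_mul,
      integral_const_mul]
  have mono' : (∫ x, (lap φ x) ^ 2) - p * (∫ x, ‖x‖ ^ a * u x ^ (p - 1) * φ x ^ 2) ≤
      C' * (∫ x, F x) - k / 2 * ∫ x, ((lap u x) ^ 2 + ‖x‖ ^ a * u x ^ (p + 1)) * (ψ x) ^ 2 := by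
    rw [← lhs, ← rhs]; exact mono
  rw [le_div_iff₀ (by positivity)]
  linarith

/-- **Finiteness of the energy for solutions of the fourth-order Hénon equation stable
outside a compact set.** Let `a ≥ 0`, `N ≥ 5`, `1 < p < (N+4+2a)/(N-4)`, and let `u` be a
positive `C⁴` solution of `Δ²u = |x|^a u^p` on `ℝ^N` which is stable outside a compact set
`Σ`. Then `Δu ∈ L²(ℝ^N)` and `|x|^a u^(p+1) ∈ L¹(ℝ^N)`. -/
theorem fourth_order_henon_stable_outside_compact_energy_finite
    (N : ℕ) (hN : 5 ≤ N) (a p : ℝ) (ha : 0 ≤ a) (hp : 1 < p)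
    (hsub : p < ((N : ℝ) + 4 + 2 * a) / ((N : ℝ) - 4))
    (u : EuclideanSpace ℝ (Fin N) → ℝ)
    (hu : ContDiff ℝ 4 u) (hupos : ∀ x, 0 < u x)
    (hequ : ∀ x, lap (lap u) x = ‖x‖ ^ a * u x ^ p)
    (K : Set (EuclideanSpace ℝ (Fin N))) (hK : IsCompact K)
    (hstable : ∀ φ : EuclideanSpace ℝ (Fin N) → ℝ,
      ContDiff ℝ 4 φ → HasCompactSupport φ → Disjoint (tsupport φ) K →
      0 ≤ (∫ x, (lap φ x) ^ 2) - p * ∫ x, ‖x‖ ^ a * u x ^ (p - 1) * φ x ^ 2) :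
    Integrable (fun x => (lap u x) ^ 2) (volume : Measure (EuclideanSpace ℝ (Fin N))) ∧
    Integrable (fun x => ‖x‖ ^ a * u x ^ (p + 1))
      (volume : Measure (EuclideanSpace ℝ (Fin N))) := by
  have hN4 : (0 : ℝ) < (N : ℝ) - 4 := by
    have : (5 : ℝ) ≤ N := by exact_mod_cast hN
    linarith
  have hp1 : 0 < p - 1 := by linarith
  have hs : (N : ℝ) < 2 * ((a + 2 * p + 2) / (p - 1)) := by
    rw [lt_div_iff₀ hN4] at hsub
    rw [← mul_div_assoc, lt_div_iff₀ hp1]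
    linarith
  obtain ⟨n, hn⟩ := exists_nat_ge (4 / (p - 1))
  rw [div_le_iff₀ hp1] at hn
  obtain ⟨ρ', hρ'⟩ := hK.isBounded.subset_ball (0 : EuclideanSpace ℝ (Fin N))
  set ρ := max ρ' 1 with hρdef
  have hρ : 1 ≤ ρ := le_max_right _ _
  have hKρ : K ⊆ ball 0 ρ := hρ'.trans (ball_subset_ball (le_max_left _ _))
  obtain ⟨c, hc, Hc⟩ := cutoff (N := N) ρ hρ
  obtain ⟨I, HI⟩ := core a p ha hp hs u hu hupos hequ K hstable n hn c ρ hc hρ hKρ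
  set f : EuclideanSpace ℝ (Fin N) → ℝ := fun x => (lap u x) ^ 2 + ‖x‖ ^ a * u x ^ (p + 1) with hf
  have cL : Continuous (lap u) := (lap_contDiff (n := 4) (m := 2) hu le_rfl).continuous
  have ce : Continuous fun x => ‖x‖ ^ a * u x ^ (p + 1) :=
    (continuous_norm.rpow_const fun x => Or.inr ha).mul
      (hu.continuous.rpow_const fun x => Or.inl (hupos x).ne')
  have cf : Continuous f := (cL.pow 2).add ce
  have e0 : ∀ x, 0 ≤ ‖x‖ ^ a * u x ^ (p + 1) := fun x =>
    mul_nonneg (rpow_nonneg (norm_nonneg _) _) (rpow_nonneg (hupos x).le _)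
  have f0 : ∀ x, 0 ≤ f x := fun x => add_nonneg (sq_nonneg _) (e0 x)
  have iball : ∀ r : ℝ, IntegrableOn f (closedBall 0 r) := fun r =>
    cf.continuousOn.integrableOn_compact (isCompact_closedBall _ _)
  have hfi : Integrable f := by
    have cov : AECover (volume : Measure (EuclideanSpace ℝ (Fin N))) Filter.atTop
        (fun R : ℕ => closedBall (0 : EuclideanSpace ℝ (Fin N)) (R : ℝ)) :=
      aecover_closedBall tendsto_natCast_atTop_atTop
    refine cov.integrable_of_integral_bounded_of_nonneg_ae
      ((∫ x in closedBall 0 (2 * ρ), f x) + I) (fun R => iball R)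
      (Filter.Eventually.of_forall f0) ?_
    filter_upwards [Filter.eventually_ge_atTop 1] with R hR
    obtain ⟨η, h4, hηc, h0, h1, hz, ho, hg, hl⟩ := Hc R (by exact_mod_cast hR)
    refine le_trans ?_ (add_le_add_right (HI η h4 hηc h0 h1 hz hg hl) _)
    have iη : Integrable fun x => f x * (η x ^ (n + 2)) ^ 2 := by
      refine (cf.mul ((h4.continuous.pow _).pow 2)).integrable_of_hasCompactSupport ?_
      refine HasCompactSupport.intro hηc fun x hx => ?_
      simp [image_eq_zero_of_notMem_tsupport hx]
    rw [← integral_indicator measurableSet_closedBall,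
      ← integral_indicator measurableSet_closedBall, ← integral_add
      ((integrable_indicator_iff measurableSet_closedBall).2 (iball _)) iη]
    refine integral_mono ((integrable_indicator_iff measurableSet_closedBall).2 (iball _))
      (((integrable_indicator_iff measurableSet_closedBall).2 (iball _)).add iη) ?_
    intro x
    have fη : 0 ≤ f x * (η x ^ (n + 2)) ^ 2 := mul_nonneg (f0 x) (sq_nonneg _)
    have ind0 : 0 ≤ Set.indicator (closedBall 0 (2 * ρ)) f x :=
      Set.indicator_nonneg (fun y _ => f0 y) x
    change Set.indicator (closedBall 0 (R : ℝ)) f x ≤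
      Set.indicator (closedBall 0 (2 * ρ)) f x + f x * (η x ^ (n + 2)) ^ 2
    by_cases hxR : x ∈ closedBall (0 : EuclideanSpace ℝ (Fin N)) (R : ℝ)
    · rw [Set.indicator_of_mem hxR]
      by_cases hx2 : x ∈ closedBall (0 : EuclideanSpace ℝ (Fin N)) (2 * ρ)
      · rw [Set.indicator_of_mem hx2]; linarith
      · have : η x = 1 := by
          refine ho x ?_ (by simpa using hxR)
          have : 2 * ρ < ‖x‖ := by simpa using hx2
          exact this.le
        rw [this]
        simpa using ind0
    · rw [Set.indicator_of_notMem hxR]; linarith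
  constructor
  · refine hfi.mono' (cL.pow 2).aestronglyMeasurable (Filter.Eventually.of_forall fun x => ?_)
    rw [Real.norm_of_nonneg (sq_nonneg _)]
    exact le_add_of_nonneg_right (e0 x)
  · refine hfi.mono' ce.aestronglyMeasurable (Filter.Eventually.of_forall fun x => ?_)
    rw [Real.norm_of_nonneg (e0 x)]
    exact le_add_of_nonneg_left (sq_nonneg _)
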